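/- arXiv:2204.07972 — 2 statements merged into one kernel-verified Lean document; each statement's English description precedes it below -/
import Mathlib

section
/- The vector function ĥ(t) = (ĥ₁(t), ĥ₂(t)) is twice differentiable on ℝ and satisfies the Jacobi equation ĥ''(t) = A(k,t)·ĥ(t) for all t ∈ ℝ (matrix-vector product), i.e. −ĥ'' + A(k,·)·ĥ = 0. -/
open Real RealInnerProductSpace

/-- `ρ(t) = (k·l/r)·√(sinh²(l·t) + cosh²(k·t))`. -/
noncomputable def fsRho (k l r t : ℝ) : ℝ :=
  k * l / r * Real.sqrt (Real.sinh (l * t) ^ 2 + Real.cosh (k * t) ^ 2)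
/-- `a(t)`, the coefficient of the Simons operator in the `n₁` direction. -/
noncomputable def fsa (k l r t : ℝ) : ℝ :=
  k ^ 2 * l ^ 2 / (r ^ 2 * fsRho k l r t ^ 2) *
    (k * Real.cosh (l * t) * Real.cosh (k * t) - l * Real.sinh (l * t) * Real.sinh (k * t))

/-- `b(t)`, the connection coefficient of the normal connection. -/
noncomputable def fsb (k l r t : ℝ) : ℝ :=
  k ^ 2 * l ^ 2 / (r ^ 2 * fsRho k l r t ^ 2) *
    (l * Real.sinh (k * t) * Real.cosh (k * t) + k * Real.sinh (l * t) * Real.cosh (l * t))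

/-- `c(t)`, the coefficient of the Simons operator in the `n₂` direction. -/
noncomputable def fsc (k l r t : ℝ) : ℝ :=
  k ^ 2 * l ^ 2 / (r ^ 2 * fsRho k l r t ^ 2) *
    (l * Real.cosh (l * t) * Real.cosh (k * t) - k * Real.sinh (l * t) * Real.sinh (k * t))

open Matrix MeasureTheory

/-- The matrix `A(m,t)` of the separated Jacobi (Sturm–Liouville) problem. -/
noncomputable def fsA (k l r m t : ℝ) : Matrix (Fin 2) (Fin 2) ℝ :=
  !![fsb k l r t ^ 2 + m ^ 2 - 2 * fsa k l r t ^ 2, -(2 * m * fsb k l r t);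
     -(2 * m * fsb k l r t), fsb k l r t ^ 2 + m ^ 2 - 2 * fsc k l r t ^ 2]

/-- The vector function `ĥ(t) = (ĥ₁(t), ĥ₂(t))`. -/
noncomputable def fsH (k l r t : ℝ) : Fin 2 → ℝ :=
  ![k * l / (r * fsRho k l r t) * Real.cosh (l * t),
    k * l / (r * fsRho k l r t) * Real.sinh (l * t)]

lemma sinh_sq_add_cosh_sq_pos (x y : ℝ) : 0 < Real.sinh x ^ 2 + Real.cosh y ^ 2 := by
  have := Real.cosh_pos y
  positivity

/-- The reciprocal of `√(sinh²(l·t) + cosh²(k·t))`, the common factor of the components of `ĥ`. -/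
noncomputable def fsU (k l t : ℝ) : ℝ :=
  (Real.sqrt (Real.sinh (l * t) ^ 2 + Real.cosh (k * t) ^ 2))⁻¹

lemma fsU_sq_mul (k l t : ℝ) :
    fsU k l t ^ 2 * (Real.sinh (l * t) ^ 2 + Real.cosh (k * t) ^ 2) = 1 := by
  have h := sinh_sq_add_cosh_sq_pos (l * t) (k * t)
  rw [fsU, inv_pow, Real.sq_sqrt h.le, inv_mul_cancel₀ h.ne']

lemma hasDerivAt_sinh_mul (l t : ℝ) :
    HasDerivAt (fun s => Real.sinh (l * s)) (l * Real.cosh (l * t)) t := by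
  simpa [mul_comm] using ((hasDerivAt_id t).const_mul l).sinh

lemma hasDerivAt_cosh_mul (l t : ℝ) :
    HasDerivAt (fun s => Real.cosh (l * s)) (l * Real.sinh (l * t)) t := by
  simpa [mul_comm] using ((hasDerivAt_id t).const_mul l).cosh

lemma hasDerivAt_fsU (k l t : ℝ) :
    HasDerivAt (fsU k l)
      (-(l * Real.sinh (l * t) * Real.cosh (l * t) + k * Real.cosh (k * t) * Real.sinh (k * t)) *
        fsU k l t ^ 3) t := by
  have h := sinh_sq_add_cosh_sq_pos (l * t) (k * t)
  refine (((((hasDerivAt_sinh_mul l t).fun_pow 2).fun_add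
    ((hasDerivAt_cosh_mul k t).fun_pow 2)).sqrt h.ne').fun_inv
    (Real.sqrt_pos.2 h).ne').congr_deriv ?_
  have h' := (Real.sqrt_pos.2 h).ne'
  simp only [fsU]
  field_simp
  ring

lemma fsH_eq_fsU {k l r : ℝ} (hk : k ≠ 0) (hl : l ≠ 0) (hr : r ≠ 0) (t : ℝ) :
    fsH k l r t = ![fsU k l t * Real.cosh (l * t), fsU k l t * Real.sinh (l * t)] := by
  have h := (Real.sqrt_pos.2 (sinh_sq_add_cosh_sq_pos (l * t) (k * t))).ne'
  have e : k * l / (r * fsRho k l r t) = fsU k l t := by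
    simp only [fsRho, fsU]
    field_simp
  rw [fsH, e]

lemma fsRho_factor_eq_fsU_sq {k l r : ℝ} (hk : k ≠ 0) (hl : l ≠ 0) (hr : r ≠ 0) (t : ℝ) :
    k ^ 2 * l ^ 2 / (r ^ 2 * fsRho k l r t ^ 2) = fsU k l t ^ 2 := by
  have h := (Real.sqrt_pos.2 (sinh_sq_add_cosh_sq_pos (l * t) (k * t))).ne'
  simp only [fsRho, fsU]
  field_simp

/-- The derivative of `ĥ`. -/
noncomputable def fsHDeriv (k l t : ℝ) : Fin 2 → ℝ :=
  ![fsU k l t * (l * Real.sinh (l * t)) -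
      (l * Real.sinh (l * t) * Real.cosh (l * t) + k * Real.cosh (k * t) * Real.sinh (k * t)) *
        fsU k l t ^ 3 * Real.cosh (l * t),
    fsU k l t * (l * Real.cosh (l * t)) -
      (l * Real.sinh (l * t) * Real.cosh (l * t) + k * Real.cosh (k * t) * Real.sinh (k * t)) *
        fsU k l t ^ 3 * Real.sinh (l * t)]

lemma hasDerivAt_fsH {k l r : ℝ} (hk : k ≠ 0) (hl : l ≠ 0) (hr : r ≠ 0) (t : ℝ) :
    HasDerivAt (fun s => fsH k l r s) (fsHDeriv k l t) t := by
  simp only [fsH_eq_fsU hk hl hr]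
  rw [hasDerivAt_pi]
  intro i
  fin_cases i
  · refine ((hasDerivAt_fsU k l t).fun_mul (hasDerivAt_cosh_mul l t)).congr_deriv ?_
    simp only [fsHDeriv, Fin.zero_eta, Matrix.cons_val_zero]
    ring
  · refine ((hasDerivAt_fsU k l t).fun_mul (hasDerivAt_sinh_mul l t)).congr_deriv ?_
    simp only [fsHDeriv, Fin.mk_one, Matrix.cons_val_one, Matrix.cons_val_zero]
    ring

lemma hasDerivAt_fsHDeriv {k l r : ℝ} (hk : k ≠ 0) (hl : l ≠ 0) (hr : r ≠ 0) (t : ℝ) :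
    HasDerivAt (fsHDeriv k l) (fsA k l r k t *ᵥ fsH k l r t) t := by
  have hU := hasDerivAt_fsU k l t
  have hS := hasDerivAt_sinh_mul l t
  have hC := hasDerivAt_cosh_mul l t
  have hp := ((hS.const_mul l).fun_mul hC).fun_add
    (((hasDerivAt_cosh_mul k t).const_mul k).fun_mul (hasDerivAt_sinh_mul k t))
  have hpU := hp.fun_mul (hU.fun_pow 3)
  have hw := fsU_sq_mul k l t
  have hCS := Real.cosh_sq (l * t)
  have hPQ := Real.cosh_sq (k * t)
  rw [hasDerivAt_pi]
  intro i
  fin_cases i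
  · refine ((hU.fun_mul (hS.const_mul l)).fun_sub (hpU.fun_mul hC)).congr_deriv ?_
    simp only [fsH_eq_fsU hk hl hr, fsA, fsa, fsb, fsc, fsRho_factor_eq_fsU_sq hk hl hr,
      Fin.zero_eta, Matrix.mulVec, dotProduct, Fin.sum_univ_two, Matrix.of_apply,
      Matrix.cons_val_zero, Matrix.cons_val_one]
    generalize fsU k l t = u at *
    generalize Real.sinh (l * t) = S at *
    generalize Real.cosh (l * t) = C at *
    generalize Real.sinh (k * t) = Q at *
    generalize Real.cosh (k * t) = P at *
    push_cast
    have key : l ^ 2 * C * (S ^ 2 + P ^ 2) ^ 2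
        - 2 * l * S * (l * S * C + k * P * Q) * (S ^ 2 + P ^ 2)
        - (l ^ 2 * (S ^ 2 + C ^ 2) + k ^ 2 * (P ^ 2 + Q ^ 2)) * C * (S ^ 2 + P ^ 2)
        + 3 * (l * S * C + k * P * Q) ^ 2 * C =
        ((l * Q * P + k * S * C) ^ 2 + k ^ 2 * (S ^ 2 + P ^ 2) ^ 2 - 2 * (k * C * P - l * S * Q) ^ 2) * C
        - 2 * k * (l * Q * P + k * S * C) * S * (S ^ 2 + P ^ 2) := by
      grind
    linear_combination u ^ 5 * key
      - (l ^ 2 - k ^ 2) * C * u * (u ^ 2 * (S ^ 2 + P ^ 2) + 1) * hw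
      - (- 2 * l * S * (l * S * C + k * P * Q)
        - (l ^ 2 * (S ^ 2 + C ^ 2) + k ^ 2 * (P ^ 2 + Q ^ 2)) * C
        + 2 * k * (l * Q * P + k * S * C) * S) * u ^ 3 * hw
  · refine ((hU.fun_mul (hC.const_mul l)).fun_sub (hpU.fun_mul hS)).congr_deriv ?_
    simp only [fsH_eq_fsU hk hl hr, fsA, fsa, fsb, fsc, fsRho_factor_eq_fsU_sq hk hl hr,
      Fin.mk_one, Matrix.mulVec, dotProduct, Fin.sum_univ_two, Matrix.of_apply,
      Matrix.cons_val_zero, Matrix.cons_val_one]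
    generalize fsU k l t = u at *
    generalize Real.sinh (l * t) = S at *
    generalize Real.cosh (l * t) = C at *
    generalize Real.sinh (k * t) = Q at *
    generalize Real.cosh (k * t) = P at *
    push_cast
    have key : l ^ 2 * S * (S ^ 2 + P ^ 2) ^ 2
        - 2 * l * C * (l * S * C + k * P * Q) * (S ^ 2 + P ^ 2)
        - (l ^ 2 * (S ^ 2 + C ^ 2) + k ^ 2 * (P ^ 2 + Q ^ 2)) * S * (S ^ 2 + P ^ 2)
        + 3 * (l * S * C + k * P * Q) ^ 2 * S =
        ((l * Q * P + k * S * C) ^ 2 + k ^ 2 * (S ^ 2 + P ^ 2) ^ 2 - 2 * (l * C * P - k * S * Q) ^ 2) * S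
        - 2 * k * (l * Q * P + k * S * C) * C * (S ^ 2 + P ^ 2) := by
      grind
    linear_combination u ^ 5 * key
      - (l ^ 2 - k ^ 2) * S * u * (u ^ 2 * (S ^ 2 + P ^ 2) + 1) * hw
      - (- 2 * l * C * (l * S * C + k * P * Q)
        - (l ^ 2 * (S ^ 2 + C ^ 2) + k ^ 2 * (P ^ 2 + Q ^ 2)) * S
        + 2 * k * (l * Q * P + k * S * C) * C) * u ^ 3 * hw

/-- `ĥ` is twice differentiable on `ℝ` and satisfies the Jacobi equation
`ĥ''(t) = A(k,t)·ĥ(t)`, i.e. `−ĥ'' + A(k,·)·ĥ = 0`. -/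
theorem stmt_10 (k l T r : ℝ) (hkl : k > l) (hl : l > 0) (hT : 0 < T)
    (hTeq : k * Real.tanh (k * T) = l * (Real.cosh (l * T) / Real.sinh (l * T)))
    (hr : r = Real.sqrt (k ^ 2 * Real.sinh (l * T) ^ 2 + l ^ 2 * Real.cosh (k * T) ^ 2)) :
    (∀ t : ℝ, DifferentiableAt ℝ (fun s => fsH k l r s) t) ∧
    (∀ t : ℝ, DifferentiableAt ℝ (deriv fun s => fsH k l r s) t) ∧
    ∀ t : ℝ, deriv (deriv fun s => fsH k l r s) t = fsA k l r k t *ᵥ fsH k l r t := by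
  have hk : 0 < k := hl.trans hkl
  have hr0 : r ≠ 0 := by
    rw [hr]
    have := Real.cosh_pos (k * T)
    exact (Real.sqrt_pos.2 (by positivity)).ne'
  have hd : deriv (fun s => fsH k l r s) = fsHDeriv k l :=
    funext fun t => (hasDerivAt_fsH hk.ne' hl.ne' hr0 t).deriv
  rw [hd]
  exact ⟨fun t => (hasDerivAt_fsH hk.ne' hl.ne' hr0 t).differentiableAt,
    fun t => (hasDerivAt_fsHDeriv hk.ne' hl.ne' hr0 t).differentiableAt,
    fun t => (hasDerivAt_fsHDeriv hk.ne' hl.ne' hr0 t).deriv⟩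
end

section
/- For every real number p ≥ 1, the function t ↦ t·(coth(t) − p·tanh(t)) is strictly decreasing on (0, ∞); in particular its limit as t → 0⁺ equals 1 and t·(coth(t) − p·tanh(t)) < 1 for all t > 0. -/
/-- `sinh t < t cosh t` for positive `t`. -/
theorem sinh_lt_mul_cosh {t : ℝ} (ht : 0 < t) : Real.sinh t < t * Real.cosh t := by
  have hd : ∀ x : ℝ, HasDerivAt (fun x : ℝ => x * Real.cosh x - Real.sinh x)
      (x * Real.sinh x) x := by
    intro x
    have h := ((hasDerivAt_id x).mul (Real.hasDerivAt_cosh x)).sub (Real.hasDerivAt_sinh x)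
    convert! h using 1
    simp
  have hm : StrictMonoOn (fun x : ℝ => x * Real.cosh x - Real.sinh x) (Set.Ici 0) := by
    refine strictMonoOn_of_deriv_pos (convex_Ici 0)
      (fun x _ => (hd x).continuousAt.continuousWithinAt) fun x hx => ?_
    rw [interior_Ici, Set.mem_Ioi] at hx
    rw [(hd x).deriv]
    exact mul_pos hx (Real.sinh_pos_iff.2 hx)
  have h := hm Set.self_mem_Ici ht.le ht
  simp at h
  exact h

theorem strictAntiOn_div_sinh : StrictAntiOn (fun t : ℝ => t / Real.sinh t) (Set.Ioi 0) := by
  have hd : ∀ x ∈ Set.Ioi (0 : ℝ), HasDerivAt (fun x : ℝ => x / Real.sinh x)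
      ((1 * Real.sinh x - x * Real.cosh x) / Real.sinh x ^ 2) x := fun x hx =>
    (hasDerivAt_id x).div (Real.hasDerivAt_sinh x) (Real.sinh_pos_iff.2 hx).ne'
  refine strictAntiOn_of_deriv_neg (convex_Ioi 0)
    (fun x hx => (hd x hx).continuousAt.continuousWithinAt) fun x hx => ?_
  rw [interior_Ioi] at hx
  rw [(hd x hx).deriv]
  have hs := Real.sinh_pos_iff.2 hx
  exact div_neg_of_neg_of_pos (by linarith [sinh_lt_mul_cosh hx]) (by positivity)

theorem tendsto_div_sinh :
    Filter.Tendsto (fun t : ℝ => t / Real.sinh t) (nhdsWithin 0 (Set.Ioi 0)) (nhds 1) := by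
  have h := (Real.hasDerivAt_sinh 0).tendsto_slope.mono_left
    (nhdsWithin_mono 0 fun x (hx : x ∈ Set.Ioi (0 : ℝ)) => hx.ne')
  have h' := h.inv₀ (by simp)
  simpa [slope_fun_def, Function.comp_def, div_eq_mul_inv, mul_comm] using h'

theorem strictMono_real_tanh : StrictMono Real.tanh := by
  intro a b hab
  rw [Real.tanh_eq_sinh_div_cosh, Real.tanh_eq_sinh_div_cosh,
    div_lt_div_iff₀ (Real.cosh_pos a) (Real.cosh_pos b)]
  have h := Real.sinh_pos_iff.2 (sub_pos.2 hab)
  rw [Real.sinh_sub] at h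
  linarith

theorem real_tanh_nonneg {t : ℝ} (ht : 0 ≤ t) : 0 ≤ Real.tanh t := by
  simpa using strictMono_real_tanh.monotone ht

theorem continuous_real_tanh : Continuous Real.tanh := by
  simp only [funext Real.tanh_eq_sinh_div_cosh]
  exact Real.continuous_sinh.div Real.continuous_cosh fun t => (Real.cosh_pos t).ne'

theorem mul_coth_sub_mul_tanh_eq (p : ℝ) {t : ℝ} (ht : 0 < t) :
    t * (Real.cosh t / Real.sinh t - p * Real.tanh t) =
      t / Real.sinh t * (Real.cosh t)⁻¹ - (p - 1) * (t * Real.tanh t) := by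
  have hs := (Real.sinh_pos_iff.2 ht).ne'
  have hc := (Real.cosh_pos t).ne'
  rw [Real.tanh_eq_sinh_div_cosh]
  field_simp
  linear_combination Real.cosh_sq_sub_sinh_sq t

/-- For every real `p ≥ 1`, the function `t ↦ t·(coth t − p·tanh t)` is strictly
decreasing on `(0, ∞)`; in particular its limit as `t → 0⁺` equals `1`, and
`t·(coth t − p·tanh t) < 1` for all `t > 0`. -/
theorem stmt_17 (p : ℝ) (hp : 1 ≤ p) :
    StrictAntiOn (fun t : ℝ => t * (Real.cosh t / Real.sinh t - p * Real.tanh t))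
      (Set.Ioi 0) ∧
    Filter.Tendsto (fun t : ℝ => t * (Real.cosh t / Real.sinh t - p * Real.tanh t))
      (nhdsWithin 0 (Set.Ioi 0)) (nhds 1) ∧
    ∀ t : ℝ, 0 < t → t * (Real.cosh t / Real.sinh t - p * Real.tanh t) < 1 := by
  refine ⟨fun a ha b hb hab => ?_, ?_, fun t ht => ?_⟩
  · have ha' : 0 < a := ha
    have hb' : 0 < b := hb
    simp only [mul_coth_sub_mul_tanh_eq p ha', mul_coth_sub_mul_tanh_eq p hb']
    have h1 := strictAntiOn_div_sinh ha hb hab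
    have h2 : (Real.cosh b)⁻¹ ≤ (Real.cosh a)⁻¹ :=
      inv_anti₀ (Real.cosh_pos a) (Real.cosh_le_cosh.2 (abs_le_abs_of_nonneg ha'.le hab.le))
    have h3 : b / Real.sinh b * (Real.cosh b)⁻¹ < a / Real.sinh a * (Real.cosh a)⁻¹ :=
      mul_lt_mul h1 h2 (inv_pos.2 (Real.cosh_pos b))
        (div_pos ha' (Real.sinh_pos_iff.2 ha')).le
    have h4 : a * Real.tanh a ≤ b * Real.tanh b :=
      mul_le_mul hab.le (strictMono_real_tanh hab).le (real_tanh_nonneg ha'.le) hb'.le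
    have h5 := mul_le_mul_of_nonneg_left h4 (sub_nonneg.2 hp)
    linarith
  · have hc : Filter.Tendsto (fun t : ℝ => (Real.cosh t)⁻¹)
        (nhdsWithin 0 (Set.Ioi 0)) (nhds (Real.cosh 0)⁻¹) :=
      ((Real.continuous_cosh.tendsto 0).inv₀ (Real.cosh_pos 0).ne').mono_left nhdsWithin_le_nhds
    have ht : Filter.Tendsto (fun t : ℝ => (p - 1) * (t * Real.tanh t))
        (nhdsWithin 0 (Set.Ioi 0)) (nhds ((p - 1) * (0 * Real.tanh 0))) :=
      ((continuous_const.mul (continuous_id.mul continuous_real_tanh)).tendsto 0).mono_left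
        nhdsWithin_le_nhds
    have h := (tendsto_div_sinh.mul hc).sub ht
    simp only [Real.cosh_zero, inv_one, mul_one, zero_mul, mul_zero, sub_zero] at h
    refine h.congr' ?_
    filter_upwards [self_mem_nhdsWithin] with t ht
    exact (mul_coth_sub_mul_tanh_eq p ht).symm
  · rw [mul_coth_sub_mul_tanh_eq p ht]
    have h1 : t / Real.sinh t < 1 :=
      (div_lt_one (Real.sinh_pos_iff.2 ht)).2 (Real.self_lt_sinh_iff.2 ht)
    have h2 : t / Real.sinh t * (Real.cosh t)⁻¹ < 1 :=
      (mul_le_of_le_one_right (div_pos ht (Real.sinh_pos_iff.2 ht)).le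
        (inv_le_one_of_one_le₀ (Real.one_le_cosh t))).trans_lt h1
    have h3 : 0 ≤ (p - 1) * (t * Real.tanh t) :=
      mul_nonneg (sub_nonneg.2 hp) (mul_nonneg ht.le (real_tanh_nonneg ht.le))
    linarith
end
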